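/- Every subdivision of the graph D_3 has spaghetti treewidth exactly three. -/

import Mathlib

open SimpleGraph

/-- The cycle graph on `ZMod n` (for `3 ≤ n` this is a cycle of length `n`). -/
def cycGraph (n : ℕ) : SimpleGraph (ZMod n) :=
  SimpleGraph.fromRel (fun x y => x = y + 1)

/-- The set `s` of nodes induces a path in the graph `H`. -/
def IsPathSet {ι : Type} (H : SimpleGraph ι) (s : Set ι) : Prop :=
  (H.induce s).Connected ∧ ∀ x ∈ s, {y | y ∈ s ∧ H.Adj x y}.ncard ≤ 2

/-- The set `s` of nodes induces a directed path in `H` with respect to the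
orientation `o` of the edges of `H`. -/
def IsDirPathSet {ι : Type} (H : SimpleGraph ι) (o : ι → ι → Prop) (s : Set ι) : Prop :=
  IsPathSet H s ∧ (∀ x ∈ s, {y | y ∈ s ∧ o x y}.ncard ≤ 1) ∧
    (∀ x ∈ s, {y | y ∈ s ∧ o y x}.ncard ≤ 1)

/-- A tree decomposition of a finite simple graph `G`. -/
structure TreeDecomp {V : Type} (G : SimpleGraph V) where
  ι : Type
  finι : Finite ι
  tree : SimpleGraph ι
  isTree : tree.IsTree
  bag : ι → Set V
  bag_cover : ∀ v : V, ∃ x, v ∈ bag x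
  bag_edge : ∀ ⦃u v : V⦄, G.Adj u v → ∃ x, u ∈ bag x ∧ v ∈ bag x
  bag_conn : ∀ v : V, (tree.induce {x | v ∈ bag x}).Connected

/-- A spaghetti tree decomposition: for every vertex `v` of `G`, the nodes whose
bags contain `v` induce a path in the tree. -/
structure SpaghettiTD {V : Type} (G : SimpleGraph V) extends TreeDecomp G where
  bag_path : ∀ v : V, IsPathSet tree {x | v ∈ bag x}

/-- A directed spaghetti tree decomposition: the tree edges are oriented, and for
every vertex `v` of `G` the nodes whose bags contain `v` induce a directed path. -/
structure DirSpaghettiTD {V : Type} (G : SimpleGraph V) extends TreeDecomp G where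
  orient : ι → ι → Prop
  orient_iff : ∀ x y : ι, tree.Adj x y ↔ (orient x y ∨ orient y x)
  orient_asymm : ∀ x y : ι, orient x y → ¬ orient y x
  bag_dirpath : ∀ v : V, IsDirPathSet tree orient {x | v ∈ bag x}

/-- A special tree decomposition: the tree is rooted, and for every vertex `v` of
`G` the nodes whose bags contain `v` induce a vertical path, i.e. a directed path
with respect to the orientation of every tree edge towards the root. -/
structure SpecialTD {V : Type} (G : SimpleGraph V) extends TreeDecomp G where
  root : ι
  bag_vertical : ∀ v : V,
    IsDirPathSet tree (fun x y => tree.Adj x y ∧ tree.dist y root < tree.dist x root)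
      {x | v ∈ bag x}

/-- A path decomposition of a finite simple graph `G`. -/
structure PathDecomp {V : Type} (G : SimpleGraph V) where
  m : ℕ
  hm : 0 < m
  bag : Fin m → Set V
  bag_cover : ∀ v : V, ∃ i, v ∈ bag i
  bag_edge : ∀ ⦃u v : V⦄, G.Adj u v → ∃ i, u ∈ bag i ∧ v ∈ bag i
  bag_convex : ∀ (v : V) (i j k : Fin m), i ≤ j → j ≤ k → v ∈ bag i → v ∈ bag k → v ∈ bag j

/-- Treewidth: minimal width of a tree decomposition. -/
noncomputable def treewidth {V : Type} (G : SimpleGraph V) : ℕ :=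
  sInf {k | ∃ td : TreeDecomp G, ∀ x, (td.bag x).ncard ≤ k + 1}

/-- Spaghetti treewidth: minimal width of a spaghetti tree decomposition. -/
noncomputable def sptw {V : Type} (G : SimpleGraph V) : ℕ :=
  sInf {k | ∃ td : SpaghettiTD G, ∀ x, (td.bag x).ncard ≤ k + 1}

/-- Directed spaghetti treewidth: minimal width of a directed spaghetti tree
decomposition. -/
noncomputable def dptw {V : Type} (G : SimpleGraph V) : ℕ :=
  sInf {k | ∃ td : DirSpaghettiTD G, ∀ x, (td.bag x).ncard ≤ k + 1}

/-- Special treewidth: minimal width of a special tree decomposition. -/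
noncomputable def spctw {V : Type} (G : SimpleGraph V) : ℕ :=
  sInf {k | ∃ td : SpecialTD G, ∀ x, (td.bag x).ncard ≤ k + 1}

/-- Pathwidth: minimal width of a path decomposition. -/
noncomputable def pw {V : Type} (G : SimpleGraph V) : ℕ :=
  sInf {k | ∃ pd : PathDecomp G, ∀ i, (pd.bag i).ncard ≤ k + 1}

/-- A graph is chordal iff it has no induced (i.e. chordless) cycle of length at
least four. -/
def IsChordal {V : Type} (G : SimpleGraph V) : Prop :=
  ∀ (S : Set V) (n : ℕ), 4 ≤ n → ¬ Nonempty ((G.induce S) ≃g cycGraph n)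

/-- A graph is strongly chordal if it is chordal and every even cycle of length at
least six has an odd chord: a chord splitting the cycle into two odd paths of
length at least three. -/
def IsStronglyChordal {V : Type} (G : SimpleGraph V) : Prop :=
  IsChordal G ∧ ∀ n : ℕ, 6 ≤ n → Even n → ∀ f : ZMod n → V,
    Function.Injective f → (∀ i : ZMod n, G.Adj (f i) (f (i + 1))) →
      ∃ (i : ZMod n) (d : ℕ), Odd d ∧ 3 ≤ d ∧ d + 3 ≤ n ∧ G.Adj (f i) (f (i + (d : ZMod n)))

/-- Strongly chordal treewidth: the minimum of `ω(H) - 1` over all strongly chordal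
supergraphs `H` of `G` (on the same vertex set; here `ω(H) ≤ k + 1` is expressed as
`H.CliqueFree (k + 2)`). -/
noncomputable def sctw {V : Type} (G : SimpleGraph V) : ℕ :=
  sInf {k | ∃ H : SimpleGraph V, G ≤ H ∧ IsStronglyChordal H ∧ H.CliqueFree (k + 2)}

/-- `H` is a minor of `G`: there is a family of nonempty, pairwise disjoint,
connected branch sets in `G`, one for each vertex of `H`, such that every edge of
`H` is realized by an edge of `G` between the corresponding branch sets. -/
def IsMinorOf {W V : Type} (H : SimpleGraph W) (G : SimpleGraph V) : Prop :=
  ∃ f : W → Set V,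
    (∀ w, (f w).Nonempty) ∧ (∀ w, (G.induce (f w)).Connected) ∧
    (Pairwise fun w w' => Disjoint (f w) (f w')) ∧
    ∀ ⦃w w'⦄, H.Adj w w' → ∃ u ∈ f w, ∃ v ∈ f w', G.Adj u v

/-- The complete graph on four vertices. -/
def K4 : SimpleGraph (Fin 4) := ⊤

/-- `D₃`: two vertices (`0` and `1`) joined by three internally vertex-disjoint
paths of length three. -/
def D3 : SimpleGraph (Fin 8) := SimpleGraph.fromRel (fun x y =>
  (x = 0 ∧ y = 2) ∨ (x = 2 ∧ y = 3) ∨ (x = 3 ∧ y = 1) ∨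
  (x = 0 ∧ y = 4) ∨ (x = 4 ∧ y = 5) ∨ (x = 5 ∧ y = 1) ∨
  (x = 0 ∧ y = 6) ∨ (x = 6 ∧ y = 7) ∨ (x = 7 ∧ y = 1))

/-- `S₃` (the 3-sun): a 6-cycle `0 1 2 3 4 5` together with the triangle `1 3 5`. -/
def S3 : SimpleGraph (Fin 6) := SimpleGraph.fromRel (fun x y =>
  (x = 0 ∧ y = 1) ∨ (x = 1 ∧ y = 2) ∨ (x = 2 ∧ y = 3) ∨ (x = 3 ∧ y = 4) ∨
  (x = 4 ∧ y = 5) ∨ (x = 5 ∧ y = 0) ∨ (x = 1 ∧ y = 3) ∨ (x = 3 ∧ y = 5) ∨ (x = 5 ∧ y = 1))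

/-- A graph is 2-connected if it has at least three vertices and deleting any one
vertex leaves it connected. -/
def TwoConnected {V : Type} (G : SimpleGraph V) : Prop :=
  3 ≤ Nat.card V ∧ ∀ v : V, (G.induce {x | x ≠ v}).Connected

/-- The cell completion of `G`: add an edge `vw` for every pair of (nonadjacent)
vertices `v, w` such that deleting `v` and `w` leaves at least three connected
components. -/
def cellCompletion {V : Type} (G : SimpleGraph V) : SimpleGraph V :=
  SimpleGraph.fromRel (fun v w => G.Adj v w ∨
    3 ≤ Nat.card ((G.induce {x | x ≠ v ∧ x ≠ w}).ConnectedComponent))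

/-- The induced subgraph of `G` on `S` has no cut vertex. -/
def NoCutVertex {V : Type} (G : SimpleGraph V) (S : Set V) : Prop :=
  ∀ v ∈ S, (S \ {v}).Nonempty → (G.induce (S \ {v})).Connected

/-- `S` carries a block of `G`: a maximal connected (induced) subgraph without a
cut vertex. -/
def IsBlock {V : Type} (G : SimpleGraph V) (S : Set V) : Prop :=
  S.Nonempty ∧ (G.induce S).Connected ∧ NoCutVertex G S ∧
    ∀ S' : Set V, S ⊆ S' → (G.induce S').Connected → NoCutVertex G S' → S' = S

/-- Glue a cycle of length `n` onto the graph `G` by identifying the cycle edge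
`{0, 1}` (with its end vertices) with the edge `{a, b}` of `G`. -/
def glueCycle {V : Type} (G : SimpleGraph V) (n : ℕ) (a b : V) :
    SimpleGraph (V ⊕ {x : ZMod n // x ≠ 0 ∧ x ≠ 1}) :=
  SimpleGraph.fromRel (fun p q =>
    match p, q with
    | Sum.inl u, Sum.inl v => G.Adj u v
    | Sum.inl u, Sum.inr x => (u = a ∧ (cycGraph n).Adj 0 x.1) ∨ (u = b ∧ (cycGraph n).Adj 1 x.1)
    | Sum.inr x, Sum.inr y => (cycGraph n).Adj x.1 y.1
    | Sum.inr _, Sum.inl _ => False)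

/-- The class of trees of cycles: every cycle is a tree of cycles, and gluing a
cycle onto a tree of cycles along an edge yields a tree of cycles (up to
isomorphism). -/
inductive IsTreeOfCycles : {V : Type} → SimpleGraph V → Prop
  | cycle {V : Type} (G : SimpleGraph V) (n : ℕ) (hn : 3 ≤ n)
      (e : Nonempty (G ≃g cycGraph n)) : IsTreeOfCycles G
  | glue {V W : Type} (G : SimpleGraph V) (hG : IsTreeOfCycles G)
      (n : ℕ) (hn : 3 ≤ n) (a b : V) (hab : G.Adj a b)
      (H : SimpleGraph W) (e : Nonempty (H ≃g glueCycle G n a b)) : IsTreeOfCycles H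

/-- `S` is the vertex set of a chordless cycle of `G`, i.e. it induces a cycle. -/
def IsChordlessCycle {V : Type} (G : SimpleGraph V) (S : Set V) : Prop :=
  ∃ n : ℕ, 3 ≤ n ∧ Nonempty ((G.induce S) ≃g cycGraph n)

/-- The edge `uv` is an edge separator: it lies in at least two distinct chordless
cycles of `G`. -/
def IsEdgeSeparator {V : Type} (G : SimpleGraph V) (u v : V) : Prop :=
  G.Adj u v ∧ ∃ S₁ S₂ : Set V, S₁ ≠ S₂ ∧ IsChordlessCycle G S₁ ∧ IsChordlessCycle G S₂ ∧
    u ∈ S₁ ∧ v ∈ S₁ ∧ u ∈ S₂ ∧ v ∈ S₂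

/-- `S` is a simplicial triangle of `G`: a chordless cycle on three vertices
containing a simplicial vertex of `G`. -/
def IsSimplicialTriangle {V : Type} (G : SimpleGraph V) (S : Set V) : Prop :=
  IsChordlessCycle G S ∧ S.ncard = 3 ∧ ∃ v ∈ S, G.IsClique (G.neighborSet v)

/-- A chain tree of cycles: a tree of cycles in which every edge lies in at most two
chordless cycles that are not simplicial triangles (equivalently, if an edge lies in
`m ≥ 3` chordless cycles then at least `m - 2` of them are simplicial triangles). -/
def IsChainTreeOfCycles {V : Type} (G : SimpleGraph V) : Prop :=
  IsTreeOfCycles G ∧ ∀ u v : V, G.Adj u v →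
    {S : Set V | IsChordlessCycle G S ∧ u ∈ S ∧ v ∈ S ∧ ¬ IsSimplicialTriangle G S}.ncard ≤ 2

/-- A tree of two-boundaried cycles: a tree of cycles in which every chordless
cycle contains at most two edge separators. -/
def IsTreeOfTwoBoundariedCycles {V : Type} (G : SimpleGraph V) : Prop :=
  IsTreeOfCycles G ∧ ∀ S : Set V, IsChordlessCycle G S →
    {e : Sym2 V | ∃ u v : V, e = s(u, v) ∧ u ∈ S ∧ v ∈ S ∧ IsEdgeSeparator G u v}.ncard ≤ 2

/-- A path of cycles: a tree of cycles in which every chordless cycle contains at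
most two edge separators and every edge lies in at most two chordless cycles that
are not simplicial triangles. -/
def IsPathOfCycles {V : Type} (G : SimpleGraph V) : Prop :=
  IsTreeOfCycles G ∧
    (∀ S : Set V, IsChordlessCycle G S →
      {e : Sym2 V | ∃ u v : V, e = s(u, v) ∧ u ∈ S ∧ v ∈ S ∧ IsEdgeSeparator G u v}.ncard ≤ 2) ∧
    ∀ u v : V, G.Adj u v →
      {S : Set V | IsChordlessCycle G S ∧ u ∈ S ∧ v ∈ S ∧ ¬ IsSimplicialTriangle G S}.ncard ≤ 2

/-- The graph is a single edge. -/
def IsSingleEdgeGraph {V : Type} (G : SimpleGraph V) : Prop :=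
  Nat.card V = 2 ∧ ∀ a b : V, a ≠ b → G.Adj a b

/-- A mamba: a 2-connected graph of pathwidth two, a single edge, or an isolated
vertex. -/
def IsMamba {V : Type} (G : SimpleGraph V) : Prop :=
  (TwoConnected G ∧ pw G = 2) ∨ IsSingleEdgeGraph G ∨ Nat.card V = 1

/-- `v` is a head vertex of the mamba `G`: some path decomposition of `G` of width
at most two has `v` in its first bag. -/
def IsHeadVertex {V : Type} (G : SimpleGraph V) (v : V) : Prop :=
  ∃ pd : PathDecomp G, (∀ i, (pd.bag i).ncard ≤ 3) ∧ v ∈ pd.bag ⟨0, pd.hm⟩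

/-- Glue the graph `M` onto the graph `G` by identifying the vertex `h` of `M` with
the vertex `x` of `G`. -/
def glueAtVertex {V W : Type} (G : SimpleGraph V) (x : V) (M : SimpleGraph W) (h : W) :
    SimpleGraph (V ⊕ {w : W // w ≠ h}) :=
  SimpleGraph.fromRel (fun p q =>
    match p, q with
    | Sum.inl u, Sum.inl u' => G.Adj u u'
    | Sum.inl u, Sum.inr w => u = x ∧ M.Adj h w.1
    | Sum.inr w, Sum.inr w' => M.Adj w.1 w'.1
    | Sum.inr _, Sum.inl _ => False)

/-- The class of mamba trees: every mamba is a mamba tree, and gluing a mamba onto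
a mamba tree by identifying a vertex of the mamba tree with a head vertex of the
mamba yields a mamba tree (up to isomorphism). -/
inductive IsMambaTree : {V : Type} → SimpleGraph V → Prop
  | mamba {V : Type} (G : SimpleGraph V) (hG : IsMamba G) : IsMambaTree G
  | glue {V W U : Type} (G : SimpleGraph V) (hG : IsMambaTree G)
      (M : SimpleGraph W) (hM : IsMamba M) (x : V) (h : W) (hh : IsHeadVertex M h)
      (K : SimpleGraph U) (e : Nonempty (K ≃g glueAtVertex G x M h)) : IsMambaTree K

/-- Subdivide the edge `{a, b}` of `G` by a new vertex. -/
def subdivideEdge {V : Type} (G : SimpleGraph V) (a b : V) : SimpleGraph (V ⊕ Unit) :=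
  SimpleGraph.fromRel (fun p q =>
    match p, q with
    | Sum.inl u, Sum.inl v => G.Adj u v ∧ ¬(u = a ∧ v = b) ∧ ¬(u = b ∧ v = a)
    | Sum.inl u, Sum.inr _ => u = a ∨ u = b
    | Sum.inr _, _ => False)

/-- `H` is a subdivision of `G`: `H` is obtained from (an isomorphic copy of) `G`
by repeatedly subdividing edges. -/
inductive IsSubdivisionOf : {W V : Type} → SimpleGraph W → SimpleGraph V → Prop
  | base {V W : Type} {G : SimpleGraph V} {H : SimpleGraph W}
      (e : Nonempty (H ≃g G)) : IsSubdivisionOf H G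
  | step {V W U : Type} {G : SimpleGraph V} {H : SimpleGraph W} (a b : W) (hab : H.Adj a b)
      (h : IsSubdivisionOf H G) {K : SimpleGraph U}
      (e : Nonempty (K ≃g subdivideEdge H a b)) : IsSubdivisionOf K G

/-- Contract the edge `{a, b}` of `G` (the contracted vertex is `a`, `b` is removed). -/
def contractEdge {V : Type} (G : SimpleGraph V) (a b : V) : SimpleGraph {x : V // x ≠ b} :=
  SimpleGraph.fromRel (fun x y =>
    G.Adj x.1 y.1 ∨ (x.1 = a ∧ G.Adj b y.1) ∨ (y.1 = a ∧ G.Adj b x.1))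

/-- Any two nodes of `S` are joined by a walk of `T` inside `S`. -/
def WalkConnected {ι : Type} (T : SimpleGraph ι) (S : Set ι) : Prop :=
  ∀ x ∈ S, ∀ y ∈ S, ∃ w : T.Walk x y, ∀ z ∈ w.support, z ∈ S

section Tree

variable {ι : Type} {T : SimpleGraph ι}

theorem walkConnected_of_induce {S : Set ι} (h : (T.induce S).Connected) :
    WalkConnected T S := by
  intro x hx y hy
  obtain ⟨w⟩ := h.preconnected ⟨x, hx⟩ ⟨y, hy⟩
  refine ⟨w.map (Embedding.induce S).toHom, fun z hz => ?_⟩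
  obtain ⟨z', -, rfl⟩ := List.mem_map.1 (Walk.support_map _ w ▸ hz)
  exact z'.2

theorem WalkConnected.support_subset {S : Set ι} (hS : WalkConnected T S) (hT : T.IsAcyclic)
    {x y : ι} (p : T.Walk x y) (hp : p.IsPath) (hx : x ∈ S) (hy : y ∈ S) :
    ∀ z ∈ p.support, z ∈ S := by
  classical
  obtain ⟨w, hw⟩ := hS x hx y hy
  have : p = w.bypass :=
    congrArg Subtype.val ((hT.subsingleton_path x y).elim ⟨p, hp⟩ ⟨w.bypass, w.bypass_isPath⟩)
  intro z hz
  rw [this] at hz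
  exact hw z (w.support_bypass_subset_support hz)

theorem WalkConnected.inter {S R : Set ι} (hS : WalkConnected T S) (hR : WalkConnected T R)
    (hT : T.IsAcyclic) : WalkConnected T (S ∩ R) := by
  classical
  intro x hx y hy
  obtain ⟨w, -⟩ := hS x hx.1 y hy.1
  exact ⟨w.bypass, fun z hz =>
    ⟨hS.support_subset hT _ w.bypass_isPath hx.1 hy.1 z hz,
      hR.support_subset hT _ w.bypass_isPath hx.2 hy.2 z hz⟩⟩

theorem mem_edges_of_isAcyclic (hT : T.IsAcyclic) {a b : ι} (hab : T.Adj a b)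
    (w : T.Walk a b) : s(a, b) ∈ w.edges :=
  isBridge_iff_forall_walk_mem_edges.1 (isAcyclic_iff_forall_adj_isBridge.1 hT hab) w

/-- Helly property for three subtrees of a tree. -/
theorem WalkConnected.helly {A B C : Set ι} (hA : WalkConnected T A) (hB : WalkConnected T B)
    (hC : WalkConnected T C) (hT : T.IsAcyclic) (hAB : (A ∩ B).Nonempty)
    (hBC : (B ∩ C).Nonempty) (hCA : (C ∩ A).Nonempty) : ∃ z, z ∈ A ∧ z ∈ B ∧ z ∈ C := by
  classical
  obtain ⟨c, hcA, hcB⟩ := hAB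
  obtain ⟨a, haB, haC⟩ := hBC
  obtain ⟨b, hbC, hbA⟩ := hCA
  by_contra! hne
  obtain ⟨w₁, hw₁⟩ := hB a haB c hcB
  obtain ⟨w₂, hw₂⟩ := hA c hcA b hbA
  have hunion : ∀ z ∈ (w₁.append w₂).bypass.support, z ∈ A ∨ z ∈ B := fun z hz => by
    have := (w₁.append w₂).support_bypass_subset_support hz
    rw [Walk.mem_support_append_iff] at this
    exact this.symm.imp (hw₂ z) (hw₁ z)
  have hpC := hC.support_subset hT _ (w₁.append w₂).bypass_isPath haC hbC
  obtain ⟨d, hd, h₁, h₂⟩ := (w₁.append w₂).bypass.exists_boundary_dart B haB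
    (fun h => hne b hbA h hbC)
  have hfst := Walk.dart_fst_mem_support_of_mem_darts _ hd
  have hsnd := Walk.dart_snd_mem_support_of_mem_darts _ hd
  have hsA : d.snd ∈ A := (hunion _ hsnd).resolve_right h₂
  have hfA : d.fst ∉ A := fun h => hne _ h h₁ (hpC _ hfst)
  obtain ⟨w₃, hw₃⟩ := hB d.fst h₁ c hcB
  obtain ⟨w₄, hw₄⟩ := hA c hcA d.snd hsA
  have := mem_edges_of_isAcyclic hT d.adj (w₃.append w₄)
  rw [Walk.edges_append, List.mem_append] at this
  rcases this with h | h
  · exact h₂ (hw₃ _ (Walk.snd_mem_support_of_mem_edges _ h))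
  · exact hfA (hw₄ _ (Walk.fst_mem_support_of_mem_edges _ h))

theorem exists_walk_avoiding {S : Set ι} {x y : ι} (w : T.Walk x y) (hy : y ∉ S)
    (h : ∃ z ∈ w.support, z ∈ S) :
    ∃ a b, T.Adj a b ∧ a ∈ S ∧ ∃ w' : T.Walk b y, ∀ z ∈ w'.support, z ∉ S := by
  induction w with
  | nil =>
    obtain ⟨z, hz, hzS⟩ := h
    rw [Walk.support_nil, List.mem_singleton] at hz
    exact absurd (hz ▸ hzS) hy
  | @cons x x' y hadj w ih =>
    by_cases hw : ∃ z ∈ w.support, z ∈ S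
    · exact ih hy hw
    · push Not at hw
      obtain ⟨z, hz, hzS⟩ := h
      rw [Walk.support_cons, List.mem_cons] at hz
      rcases hz with rfl | hz
      · exact ⟨z, x', hadj, hzS, w, hw⟩
      · exact absurd hzS (hw z hz)

/-- In a node set of maximum degree two, three neighbours of a node cannot be distinct. -/
theorem eq_of_ncard_neighbors_le_two [Finite ι] {S : Set ι} {x a b c : ι}
    (h : {y | y ∈ S ∧ T.Adj x y}.ncard ≤ 2) (ha : a ∈ S) (hb : b ∈ S) (hc : c ∈ S)
    (hxa : T.Adj x a) (hxb : T.Adj x b) (hxc : T.Adj x c) (hab : a ≠ b) : c = a ∨ c = b := by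
  by_contra! hne
  have h3 : ({a, b, c} : Set ι).ncard = 3 :=
    Set.ncard_eq_three.2 ⟨a, b, c, hab, hne.1.symm, hne.2.symm, rfl⟩
  have hle : ({a, b, c} : Set ι).ncard ≤ {y | y ∈ S ∧ T.Adj x y}.ncard := by
    apply Set.ncard_le_ncard _ (Set.toFinite _)
    rintro y (rfl | rfl | rfl)
    exacts [⟨ha, hxa⟩, ⟨hb, hxb⟩, ⟨hc, hxc⟩]
  omega

theorem adj_getVert_pred {x y : ι} (p : T.Walk x y) {i : ℕ} (h₀ : 0 < i) (hi : i ≤ p.length) :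
    T.Adj (p.getVert i) (p.getVert (i - 1)) := by
  have := p.adj_getVert_succ (i := i - 1) (by omega)
  rw [Nat.sub_add_cancel h₀] at this
  exact this.symm

theorem getVert_pred_ne_succ {x y : ι} {p : T.Walk x y} (hp : p.IsPath) {i : ℕ}
    (hi : i < p.length) (h₀ : 0 < i) : p.getVert (i - 1) ≠ p.getVert (i + 1) := by
  intro h
  have := hp.getVert_injOn (show i - 1 ≤ p.length by omega) (show i + 1 ≤ p.length by omega) h
  omega

/-- A connected node set of maximum degree two is the support of a path. -/
theorem exists_isPath_support_eq [Finite ι] {S : Set ι} (hS : WalkConnected T S)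
    (hdeg : ∀ x ∈ S, {y | y ∈ S ∧ T.Adj x y}.ncard ≤ 2) (hne : S.Nonempty) :
    ∃ (x y : ι) (p : T.Walk x y), p.IsPath ∧ ∀ z, z ∈ p.support ↔ z ∈ S := by
  classical
  have := Fintype.ofFinite ι
  let L : Set ℕ := {n | ∃ (x y : ι) (p : T.Walk x y),
    p.IsPath ∧ (∀ z ∈ p.support, z ∈ S) ∧ p.length = n}
  obtain ⟨s, hs⟩ := hne
  have hL : L.Nonempty := ⟨0, s, s, Walk.nil, Walk.IsPath.nil, by simpa using hs, rfl⟩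
  have hbdd : BddAbove L := ⟨Fintype.card ι, by
    rintro _ ⟨x, y, p, hp, -, rfl⟩
    exact hp.length_lt.le⟩
  obtain ⟨x, y, p, hp, hpS, hlen⟩ := Nat.sSup_mem hL hbdd
  have hmax : ∀ (x' y' : ι) (q : T.Walk x' y'), q.IsPath → (∀ z ∈ q.support, z ∈ S) →
      q.length ≤ p.length := fun x' y' q hq hqS =>
    hlen ▸ le_csSup hbdd ⟨x', y', q, hq, hqS, rfl⟩
  refine ⟨x, y, p, hp, fun z => ⟨hpS z, fun hz => ?_⟩⟩
  by_contra hzp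
  obtain ⟨w, hw⟩ := hS x (hpS x p.start_mem_support) z hz
  obtain ⟨d, hd, h₁, h₂⟩ := w.exists_boundary_dart {v | v ∈ p.support} p.start_mem_support hzp
  have hdS : d.snd ∈ S := hw _ (w.dart_snd_mem_support_of_mem_darts hd)
  obtain ⟨i, hi, hil⟩ := Walk.mem_support_iff_exists_getVert.1 h₁
  have hadj : T.Adj (p.getVert i) d.snd := hi ▸ d.adj
  rcases Nat.eq_zero_or_pos i with rfl | hpos
  · rw [Walk.getVert_zero] at hadj
    have := hmax _ _ (Walk.cons hadj.symm p) ((Walk.cons_isPath_iff _ _).2 ⟨hp, h₂⟩) (by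
      simpa using ⟨hdS, hpS⟩)
    simp at this
  rcases hil.eq_or_lt with rfl | hlt
  · rw [Walk.getVert_length] at hadj
    have := hmax _ _ (p.concat hadj) (hp.concat h₂ hadj) (by
      intro z hz
      rw [Walk.support_concat, List.mem_append, List.mem_singleton] at hz
      rcases hz with hz | rfl
      exacts [hpS z hz, hdS])
    simp at this
  rcases eq_of_ncard_neighbors_le_two (hdeg _ (hpS _ (p.getVert_mem_support i)))
    (hpS _ (p.getVert_mem_support (i - 1))) (hpS _ (p.getVert_mem_support (i + 1))) hdS
    (adj_getVert_pred p hpos hil) (p.adj_getVert_succ hlt) hadj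
    (getVert_pred_ne_succ hp hlt hpos) with h | h
  · exact h₂ (h ▸ p.getVert_mem_support _)
  · exact h₂ (h ▸ p.getVert_mem_support _)

/-- A walk in `S ∩ R` that starts strictly between two path nodes outside `R` cannot leave that
part of the path, when `S` contains the path and has maximum degree two. -/
theorem exists_getVert_eq_of_walk [Finite ι] {S R : Set ι}
    (hdeg : ∀ x ∈ S, {y | y ∈ S ∧ T.Adj x y}.ncard ≤ 2) {a b : ι} {p : T.Walk a b}
    (hp : p.IsPath) (hpS : ∀ z ∈ p.support, z ∈ S) {i k : ℕ} (hk : k ≤ p.length)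
    (hiR : p.getVert i ∉ R) (hkR : p.getVert k ∉ R) {x y : ι} (w : T.Walk x y)
    (hw : ∀ z ∈ w.support, z ∈ S ∩ R) (hx : ∃ j, i < j ∧ j < k ∧ p.getVert j = x) :
    ∃ j, i < j ∧ j < k ∧ p.getVert j = y := by
  induction w with
  | nil => exact hx
  | @cons x x' y hadj w ih =>
    refine ih (fun z hz => hw z (by simp [hz])) ?_
    obtain ⟨j, hij, hjk, rfl⟩ := hx
    obtain ⟨hS', hR'⟩ := hw x' (by simp)
    rcases eq_of_ncard_neighbors_le_two (hdeg _ (hpS _ (p.getVert_mem_support j)))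
      (hpS _ (p.getVert_mem_support (j - 1))) (hpS _ (p.getVert_mem_support (j + 1))) hS'
      (adj_getVert_pred p (by omega) (by omega)) (p.adj_getVert_succ (by omega)) hadj
      (getVert_pred_ne_succ hp (by omega) (by omega)) with h | h
    · refine ⟨j - 1, ?_, by omega, h.symm⟩
      rcases Nat.lt_or_ge i (j - 1) with h' | h'
      · exact h'
      · obtain rfl : i = j - 1 := by omega
        exact absurd (h ▸ hR') hiR
    · refine ⟨j + 1, by omega, ?_, h.symm⟩
      rcases Nat.lt_or_ge (j + 1) k with h' | h'
      · exact h'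
      · obtain rfl : k = j + 1 := by omega
        exact absurd (h ▸ hR') hkR

end Tree

/-- Two vertices of `P` are adjacent inside `P`. -/
def AdjIn {V : Type} (G : SimpleGraph V) (P : Set V) (a b : V) : Prop :=
  a ∈ P ∧ b ∈ P ∧ G.Adj a b

/-- Every two vertices of `P` are joined by a walk of `G` inside `P`. -/
def ChainConnected {V : Type} (G : SimpleGraph V) (P : Set V) : Prop :=
  ∀ x ∈ P, ∀ y ∈ P, Relation.ReflTransGen (AdjIn G P) x y

/-- Two vertices `s` and `t` together with three disjoint connected sets `P i`, each
containing a neighbour `u i` of `s` and a different neighbour `w i` of `t`. -/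
structure ThetaModel {V : Type} (G : SimpleGraph V) where
  s : V
  t : V
  P : Fin 3 → Set V
  u : Fin 3 → V
  w : Fin 3 → V
  ne : s ≠ t
  s_notMem : ∀ i, s ∉ P i
  t_notMem : ∀ i, t ∉ P i
  disj : ∀ i j v, v ∈ P i → v ∈ P j → i = j
  u_mem : ∀ i, u i ∈ P i
  w_mem : ∀ i, w i ∈ P i
  u_ne_w : ∀ i, u i ≠ w i
  adj_u : ∀ i, G.Adj s (u i)
  adj_w : ∀ i, G.Adj t (w i)
  conn : ∀ i, ChainConnected G (P i)

section LowerBound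

variable {V : Type} {G : SimpleGraph V}

namespace TreeDecomp

/-- The nodes whose bags meet `P`. -/
def nodes (td : TreeDecomp G) (P : Set V) : Set td.ι := {x | ∃ v ∈ P, v ∈ td.bag x}

theorem walkConnected_bag (td : TreeDecomp G) (v : V) :
    WalkConnected td.tree {x | v ∈ td.bag x} :=
  walkConnected_of_induce (td.bag_conn v)

/-- For connected `P`, nodes whose bags meet `P` are joined by a walk such that the end bags of
each of its edges have a common vertex in `P`. -/
theorem exists_walk_of_chainConnected (td : TreeDecomp G) {P : Set V} (hP : ChainConnected G P)
    {u v : V} (hu : u ∈ P) (hv : v ∈ P) {x y : td.ι} (hx : u ∈ td.bag x) (hy : v ∈ td.bag y) :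
    ∃ w : td.tree.Walk x y, (∀ z ∈ w.support, z ∈ td.nodes P) ∧
      ∀ a b, s(a, b) ∈ w.edges → ∃ p ∈ P, p ∈ td.bag a ∧ p ∈ td.bag b := by
  have key : ∀ p ∈ P, ∀ x y : td.ι, p ∈ td.bag x → p ∈ td.bag y →
      ∃ w : td.tree.Walk x y, (∀ z ∈ w.support, z ∈ td.nodes P) ∧
        ∀ a b, s(a, b) ∈ w.edges → ∃ p ∈ P, p ∈ td.bag a ∧ p ∈ td.bag b := by
    intro p hp x y hx hy
    obtain ⟨w, hw⟩ := td.walkConnected_bag p x hx y hy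
    exact ⟨w, fun z hz => ⟨p, hp, hw z hz⟩, fun a b hab =>
      ⟨p, hp, hw a (w.fst_mem_support_of_mem_edges hab),
        hw b (w.snd_mem_support_of_mem_edges hab)⟩⟩
  have chain := hP u hu v hv
  induction chain generalizing y with
  | refl => exact key u hu x y hx hy
  | @tail b c _ hbc ih =>
    obtain ⟨z, hz₁, hz₂⟩ := td.bag_edge hbc.2.2
    obtain ⟨w₁, h₁, h₁'⟩ := ih hbc.1 hz₁
    obtain ⟨w₂, h₂, h₂'⟩ := key c hbc.2.1 z y hz₂ hy
    refine ⟨w₁.append w₂, fun a ha => ?_, fun a b hab => ?_⟩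
    · rw [Walk.mem_support_append_iff] at ha
      exact ha.elim (h₁ a) (h₂ a)
    · rw [Walk.edges_append, List.mem_append] at hab
      exact hab.elim (h₁' a b) (h₂' a b)

theorem walkConnected_nodes (td : TreeDecomp G) {P : Set V} (hP : ChainConnected G P) :
    WalkConnected td.tree (td.nodes P) := by
  rintro x ⟨u, hu, hx⟩ y ⟨v, hv, hy⟩
  obtain ⟨w, hw, -⟩ := td.exists_walk_of_chainConnected hP hu hv hx hy
  exact ⟨w, hw⟩

end TreeDecomp

theorem not_mem_of_ncard_le_three [Finite V] {B : Set V} (h : B.ncard ≤ 3) {a b c d : V}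
    (ha : a ∈ B) (hb : b ∈ B) (hc : c ∈ B) (hab : a ≠ b) (hac : a ≠ c) (had : a ≠ d)
    (hbc : b ≠ c) (hbd : b ≠ d) (hcd : c ≠ d) : d ∉ B := by
  intro hd
  have hs : ({a, b, c, d} : Set V) ⊆ B := by
    rintro x (rfl | rfl | rfl | rfl) <;> assumption
  have h4 : ({a, b, c, d} : Set V).ncard = 4 := by
    rw [Set.ncard_insert_of_notMem (by simp [hab, hac, had]), Set.ncard_eq_three.2
      ⟨b, c, d, hbc, hbd, hcd, rfl⟩]
  have := Set.ncard_le_ncard hs (Set.toFinite _)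
  omega

namespace ThetaModel

variable (M : ThetaModel G)

theorem nodes_inter_s_nonempty (td : TreeDecomp G) (i : Fin 3) :
    ∃ x, M.s ∈ td.bag x ∧ x ∈ td.nodes (M.P i) := by
  obtain ⟨x, h₁, h₂⟩ := td.bag_edge (M.adj_u i)
  exact ⟨x, h₁, _, M.u_mem i, h₂⟩

theorem nodes_inter_t_nonempty (td : TreeDecomp G) (i : Fin 3) :
    ∃ x, M.t ∈ td.bag x ∧ x ∈ td.nodes (M.P i) := by
  obtain ⟨x, h₁, h₂⟩ := td.bag_edge (M.adj_w i)
  exact ⟨x, h₁, _, M.w_mem i, h₂⟩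

theorem exists_bag_terminals [Finite V] (td : TreeDecomp G)
    (hw : ∀ x, (td.bag x).ncard ≤ 3) : ∃ x, M.s ∈ td.bag x ∧ M.t ∈ td.bag x := by
  by_contra! hne
  obtain ⟨x, hx⟩ := td.bag_cover M.s
  obtain ⟨y, hy⟩ := td.bag_cover M.t
  obtain ⟨w⟩ := td.isTree.connected.preconnected x y
  obtain ⟨a, b, hab, ha, w', hw'⟩ := exists_walk_avoiding (S := {z | M.s ∈ td.bag z}) w
    (fun h => hne y h hy) ⟨x, w.start_mem_support, hx⟩
  have hb : M.s ∉ td.bag b := hw' b w'.start_mem_support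
  have key : ∀ i, ∃ p ∈ M.P i, p ∈ td.bag a := by
    intro i
    obtain ⟨c, hcs, p, hp, hcp⟩ := M.nodes_inter_s_nonempty td i
    obtain ⟨d, hdt, q, hq, hdq⟩ := M.nodes_inter_t_nonempty td i
    obtain ⟨w₁, hw₁⟩ := td.walkConnected_bag M.s a ha c hcs
    obtain ⟨w₂, -, hw₂⟩ := td.exists_walk_of_chainConnected (M.conn i) hp hq hcp hdq
    obtain ⟨w₃, hw₃⟩ := td.walkConnected_bag M.t d hdt y hy
    have := mem_edges_of_isAcyclic td.isTree.isAcyclic hab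
      (w₁.append (w₂.append (w₃.append w'.reverse)))
    simp only [Walk.edges_append, List.mem_append, Walk.edges_reverse, List.mem_reverse] at this
    rcases this with h | h | h | h
    · exact absurd (hw₁ b (w₁.snd_mem_support_of_mem_edges h)) hb
    · obtain ⟨p, hp, hpa, -⟩ := hw₂ a b h
      exact ⟨p, hp, hpa⟩
    · exact absurd (hw₃ a (w₃.fst_mem_support_of_mem_edges h)) (hne a ha)
    · exact absurd ha (hw' a (w'.fst_mem_support_of_mem_edges h))
  choose p hp hpa using key
  have hps : ∀ i, M.s ≠ p i := fun i h => M.s_notMem i (h ▸ hp i)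
  have hpp : ∀ i j, i ≠ j → p i ≠ p j := fun i j hij h =>
    hij (M.disj i j _ (hp i) (h ▸ hp j))
  exact not_mem_of_ncard_le_three (hw a) ha (hpa 0) (hpa 1) (hps 0) (hps 1) (hps 2)
    (hpp 0 1 (by decide)) (hpp 0 2 (by decide)) (hpp 1 2 (by decide)) (hpa 2)

/-- Each of the three connected sets meets the bag of a node shared by both terminals. -/
theorem exists_bag_terminals_path [Finite V] (td : TreeDecomp G)
    (hw : ∀ x, (td.bag x).ncard ≤ 3) (i : Fin 3) :
    ∃ x, M.s ∈ td.bag x ∧ M.t ∈ td.bag x ∧ x ∈ td.nodes (M.P i) := by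
  obtain ⟨a, has, hat⟩ := M.exists_bag_terminals td hw
  obtain ⟨b, hbs, hbP⟩ := M.nodes_inter_s_nonempty td i
  obtain ⟨c, hct, hcP⟩ := M.nodes_inter_t_nonempty td i
  exact (td.walkConnected_bag M.s).helly (td.walkConnected_bag M.t)
    (td.walkConnected_nodes (M.conn i)) td.isTree.isAcyclic ⟨a, has, hat⟩ ⟨c, hct, hcP⟩
    ⟨b, hbP, hbs⟩

theorem notMem_nodes_of_ne [Finite V] (td : TreeDecomp G) (hw : ∀ x, (td.bag x).ncard ≤ 3)
    {i j : Fin 3} (hij : i ≠ j) {x : td.ι} (hs : M.s ∈ td.bag x) (ht : M.t ∈ td.bag x)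
    (hx : x ∈ td.nodes (M.P i)) : x ∉ td.nodes (M.P j) := by
  rintro ⟨q, hq, hqx⟩
  obtain ⟨p, hp, hpx⟩ := hx
  refine not_mem_of_ncard_le_three (hw x) hs ht hpx M.ne ?_ ?_ ?_ ?_ ?_ hqx
  · exact fun h => M.s_notMem i (h ▸ hp)
  · exact fun h => M.s_notMem j (h ▸ hq)
  · exact fun h => M.t_notMem i (h ▸ hp)
  · exact fun h => M.t_notMem j (h ▸ hq)
  · exact fun h => hij (M.disj i j _ hp (h ▸ hq))

/-- In a tree decomposition of width two, some bag witnessing the adjacency of `P i` to one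
terminal does not contain the other terminal. -/
theorem exists_node_not_both_terminals [Finite V] (td : TreeDecomp G)
    (hw : ∀ x, (td.bag x).ncard ≤ 3) (i : Fin 3)
    (hs : ∀ x, M.s ∈ td.bag x → x ∈ td.nodes (M.P i) → M.t ∈ td.bag x)
    (ht : ∀ x, M.t ∈ td.bag x → x ∈ td.nodes (M.P i) → M.s ∈ td.bag x) : False := by
  obtain ⟨x, hxs, hxu⟩ := td.bag_edge (M.adj_u i)
  obtain ⟨y, hyt, hyw⟩ := td.bag_edge (M.adj_w i)
  have hxP : x ∈ td.nodes (M.P i) := ⟨_, M.u_mem i, hxu⟩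
  have hyP : y ∈ td.nodes (M.P i) := ⟨_, M.w_mem i, hyw⟩
  have unique : ∀ z p q, M.s ∈ td.bag z → M.t ∈ td.bag z → p ∈ M.P i → q ∈ M.P i →
      p ≠ q → p ∈ td.bag z → q ∉ td.bag z := fun z p q hzs hzt hp hq hpq hpz =>
    not_mem_of_ncard_le_three (hw z) hzs hzt hpz M.ne (fun h => M.s_notMem i (h ▸ hp))
      (fun h => M.s_notMem i (h ▸ hq)) (fun h => M.t_notMem i (h ▸ hp))
      (fun h => M.t_notMem i (h ▸ hq)) hpq
  obtain ⟨w, hwS⟩ := (((td.walkConnected_bag M.s).inter (td.walkConnected_bag M.t)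
    td.isTree.isAcyclic).inter (td.walkConnected_nodes (M.conn i)) td.isTree.isAcyclic)
    x ⟨⟨hxs, hs x hxs hxP⟩, hxP⟩ y ⟨⟨ht y hyt hyP, hyt⟩, hyP⟩
  obtain ⟨d, hd, h₁, h₂⟩ := w.exists_boundary_dart {z | M.u i ∈ td.bag z} hxu
    (fun h => unique y _ _ (ht y hyt hyP) hyt (M.u_mem i) (M.w_mem i) (M.u_ne_w i) h hyw)
  obtain ⟨⟨has, hat⟩, -⟩ := hwS _ (w.dart_fst_mem_support_of_mem_darts hd)
  obtain ⟨-, q, hq, hqb⟩ := hwS _ (w.dart_snd_mem_support_of_mem_darts hd)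
  obtain ⟨w', -, hw'⟩ := td.exists_walk_of_chainConnected (M.conn i) (M.u_mem i) hq h₁ hqb
  obtain ⟨p, hp, hpa, hpb⟩ := hw' _ _ (mem_edges_of_isAcyclic td.isTree.isAcyclic d.adj w')
  exact unique _ _ _ has hat (M.u_mem i) hp (fun h => h₂ (h ▸ hpb)) h₁ hpa

theorem false_of_index_lt [Finite V] (td : SpaghettiTD G) (hw : ∀ x, (td.bag x).ncard ≤ 3)
    {a b : td.ι} {p : td.tree.Walk a b} (hp : p.IsPath)
    (hpQ : ∀ z, z ∈ p.support ↔ M.s ∈ td.bag z ∧ M.t ∈ td.bag z) {i j k : Fin 3}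
    (hij : i ≠ j) (hkj : k ≠ j) {n : Fin 3 → ℕ}
    (hn : ∀ l, n l ≤ p.length ∧ p.getVert (n l) ∈ td.nodes (M.P l))
    (h₁ : n i < n j) (h₂ : n j < n k) : False := by
  have := td.finι
  have hQ : ∀ l, M.s ∈ td.bag (p.getVert l) ∧ M.t ∈ td.bag (p.getVert l) := fun l =>
    (hpQ _).1 (p.getVert_mem_support l)
  have hout : ∀ l, l ≠ j → p.getVert (n l) ∉ td.nodes (M.P j) := fun l hl =>
    M.notMem_nodes_of_ne td.toTreeDecomp hw hl (hQ _).1 (hQ _).2 (hn l).2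
  have key : ∀ v, (∀ z ∈ p.support, v ∈ td.bag z) → ∀ x, v ∈ td.bag x →
      x ∈ td.nodes (M.P j) → M.s ∈ td.bag x ∧ M.t ∈ td.bag x := by
    intro v hv x hx hxP
    obtain ⟨w, hwS⟩ := ((td.walkConnected_bag v).inter (td.walkConnected_nodes (M.conn j))
      td.isTree.isAcyclic) (p.getVert (n j)) ⟨hv _ (p.getVert_mem_support _), (hn j).2⟩ x ⟨hx, hxP⟩
    obtain ⟨m, -, -, rfl⟩ := exists_getVert_eq_of_walk (td.bag_path v).2 hp hv (hn k).1
      (hout i hij) (hout k hkj) w hwS ⟨_, h₁, h₂, rfl⟩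
    exact hQ m
  exact M.exists_node_not_both_terminals td.toTreeDecomp hw j
    (fun x hx hxP => (key M.s (fun z hz => ((hpQ z).1 hz).1) x hx hxP).2)
    (fun x hx hxP => (key M.t (fun z hz => ((hpQ z).1 hz).2) x hx hxP).1)

/-- A graph with a theta model has no spaghetti tree decomposition of width two. -/
theorem exists_three_lt_ncard_bag (M : ThetaModel G) [Finite V] (td : SpaghettiTD G) :
    ∃ x, 3 < (td.bag x).ncard := by
  by_contra! hw
  have := td.finι
  obtain ⟨x, hx⟩ := M.exists_bag_terminals td.toTreeDecomp hw
  obtain ⟨a, b, p, hp, hpQ⟩ := exists_isPath_support_eq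
    (S := {x | M.s ∈ td.bag x} ∩ {x | M.t ∈ td.bag x})
    ((td.walkConnected_bag M.s).inter (td.walkConnected_bag M.t) td.isTree.isAcyclic)
    (fun z hz => (Set.ncard_le_ncard (by exact fun y hy => ⟨hy.1.1, hy.2⟩)
      (Set.toFinite _)).trans ((td.bag_path M.s).2 z hz.1)) ⟨x, hx⟩
  have hnode : ∀ l, ∃ m, m ≤ p.length ∧ p.getVert m ∈ td.nodes (M.P l) := by
    intro l
    obtain ⟨z, hzs, hzt, hzP⟩ := M.exists_bag_terminals_path td.toTreeDecomp hw l
    obtain ⟨m, rfl, hm⟩ := Walk.mem_support_iff_exists_getVert.1 ((hpQ z).2 ⟨hzs, hzt⟩)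
    exact ⟨m, hm, hzP⟩
  choose n hn using hnode
  have hne : ∀ l m, l ≠ m → n l ≠ n m := by
    intro l m hlm h
    obtain ⟨h₁, h₂⟩ := (hpQ _).1 (p.getVert_mem_support (n l))
    exact M.notMem_nodes_of_ne td.toTreeDecomp hw hlm h₁ h₂ (hn l).2 (h ▸ (hn m).2)
  have key : ∀ i j k : Fin 3, i ≠ j → k ≠ j → ¬ (n i < n j ∧ n j < n k) :=
    fun i j k hij hkj h => M.false_of_index_lt td hw hp hpQ hij hkj hn h.1 h.2
  have h01 := hne 0 1 (by decide)
  have h02 := hne 0 2 (by decide)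
  have h12 := hne 1 2 (by decide)
  have := key 0 1 2 (by decide) (by decide)
  have := key 2 1 0 (by decide) (by decide)
  have := key 1 0 2 (by decide) (by decide)
  have := key 2 0 1 (by decide) (by decide)
  have := key 0 2 1 (by decide) (by decide)
  have := key 1 2 0 (by decide) (by decide)
  omega

end ThetaModel

end LowerBound

section SubdivideEdge

variable {V : Type} {G : SimpleGraph V} {a b : V}

@[simp]
theorem subdivideEdge_adj_inl_inl {u v : V} :
    (subdivideEdge G a b).Adj (Sum.inl u) (Sum.inl v) ↔
      G.Adj u v ∧ ¬(u = a ∧ v = b) ∧ ¬(u = b ∧ v = a) := by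
  simp only [subdivideEdge, fromRel_adj, ne_eq, Sum.inl.injEq, G.adj_comm v u]
  constructor
  · tauto
  · exact fun h => ⟨h.1.ne, Or.inl h⟩

@[simp]
theorem subdivideEdge_adj_inl_inr {u : V} {c : Unit} :
    (subdivideEdge G a b).Adj (Sum.inl u) (Sum.inr c) ↔ u = a ∨ u = b := by
  simp [subdivideEdge]

@[simp]
theorem subdivideEdge_adj_inr_inl {u : V} {c : Unit} :
    (subdivideEdge G a b).Adj (Sum.inr c) (Sum.inl u) ↔ u = a ∨ u = b := by
  simp [subdivideEdge]

@[simp]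
theorem subdivideEdge_adj_inr_inr {c d : Unit} :
    ¬ (subdivideEdge G a b).Adj (Sum.inr c) (Sum.inr d) := by
  simp [subdivideEdge]

theorem subdivideEdge_swap (G : SimpleGraph V) (a b : V) :
    subdivideEdge G a b = subdivideEdge G b a := by
  ext (u | c) (v | d) <;> simp <;> tauto

end SubdivideEdge

/-- A property of graphs that is invariant under isomorphism and edge subdivision passes from a
graph to all of its subdivisions. -/
theorem IsSubdivisionOf.of_invariant {p : {V : Type} → SimpleGraph V → Prop}
    (hiso : ∀ {V W : Type} {G : SimpleGraph V} {K : SimpleGraph W}, (K ≃g G) → p G → p K)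
    (hsub : ∀ {V : Type} {G : SimpleGraph V} {a b : V}, G.Adj a b → p G →
      p (subdivideEdge G a b))
    {W V : Type} {H : SimpleGraph W} {G : SimpleGraph V} (h : IsSubdivisionOf H G) (hG : p G) :
    p H := by
  induction h with
  | base e => exact e.elim fun e => hiso e hG
  | step a b hab _ e ih => exact e.elim fun e => hiso e (hsub hab (ih hG))

namespace ThetaModel

variable {V : Type} {G : SimpleGraph V}

/-- The preimage of a theta model under an isomorphism. -/
def comapIso {W : Type} {K : SimpleGraph W} (e : K ≃g G) (M : ThetaModel G) : ThetaModel K where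
  s := e.symm M.s
  t := e.symm M.t
  P i := e ⁻¹' M.P i
  u i := e.symm (M.u i)
  w i := e.symm (M.w i)
  ne h := M.ne (e.symm.injective h)
  s_notMem i := by simpa using M.s_notMem i
  t_notMem i := by simpa using M.t_notMem i
  disj i j v := M.disj i j (e v)
  u_mem i := by simpa using M.u_mem i
  w_mem i := by simpa using M.w_mem i
  u_ne_w i h := M.u_ne_w i (e.symm.injective h)
  adj_u i := e.symm.map_adj_iff.2 (M.adj_u i)
  adj_w i := e.symm.map_adj_iff.2 (M.adj_w i)
  conn i x hx y hy := by
    have := (M.conn i (e x) hx (e y) hy).lift (p := AdjIn K (e ⁻¹' M.P i)) e.symm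
      fun c d h => ⟨by simpa using h.1, by simpa using h.2.1, e.symm.map_adj_iff.2 h.2.2⟩
    simpa [Function.onFun] using this

/-- The subdivision vertex of the edge `ab` belongs to the `i`-th part after subdividing. -/
def MidMem (M : ThetaModel G) (a b : V) (i : Fin 3) : Prop :=
  (a ∈ M.P i ∧ (b ∈ M.P i ∨ b = M.s ∨ b = M.t)) ∨ (b ∈ M.P i ∧ (a = M.s ∨ a = M.t))

/-- The parts of the theta model after subdividing the edge `ab`. -/
def subdividePart (M : ThetaModel G) (a b : V) (i : Fin 3) : Set (V ⊕ Unit) :=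
  {x | (∃ v ∈ M.P i, x = Sum.inl v) ∨ (x = Sum.inr () ∧ M.MidMem a b i)}

theorem chainConnected_subdividePart (M : ThetaModel G) (a b : V) (i : Fin 3) :
    ChainConnected (subdivideEdge G a b) (M.subdividePart a b i) := by
  have hinl : ∀ v ∈ M.P i, (Sum.inl v : V ⊕ Unit) ∈ M.subdividePart a b i :=
    fun v hv => Or.inl ⟨v, hv, rfl⟩
  have hold : ∀ x ∈ M.P i, ∀ y ∈ M.P i,
      Relation.ReflTransGen (AdjIn (subdivideEdge G a b) (M.subdividePart a b i))
        (Sum.inl x) (Sum.inl y) := by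
    intro x hx y hy
    refine (M.conn i x hx y hy).lift' Sum.inl fun c d ⟨hc, hd, hcd⟩ => ?_
    by_cases hedge : (c = a ∧ d = b) ∨ (c = b ∧ d = a)
    · have hmid : (Sum.inr () : V ⊕ Unit) ∈ M.subdividePart a b i := by
        refine Or.inr ⟨rfl, Or.inl ?_⟩
        rcases hedge with ⟨rfl, rfl⟩ | ⟨rfl, rfl⟩
        exacts [⟨hc, Or.inl hd⟩, ⟨hd, Or.inl hc⟩]
      refine (Relation.ReflTransGen.single ⟨hinl c hc, hmid, ?_⟩).tail ⟨hmid, hinl d hd, ?_⟩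
      · simp; tauto
      · simp; tauto
    · refine Relation.ReflTransGen.single ⟨hinl c hc, hinl d hd, ?_⟩
      simp; tauto
  have hnear : ∀ x ∈ M.subdividePart a b i, ∃ v ∈ M.P i,
      Relation.ReflTransGen (AdjIn (subdivideEdge G a b) (M.subdividePart a b i)) x (Sum.inl v) ∧
      Relation.ReflTransGen (AdjIn (subdivideEdge G a b) (M.subdividePart a b i))
        (Sum.inl v) x := by
    intro x hx
    obtain ⟨v, hv, rfl⟩ | ⟨rfl, hmid⟩ := id hx
    · exact ⟨v, hv, .refl, .refl⟩
    · obtain ⟨v, hv, hvab⟩ : ∃ v ∈ M.P i, v = a ∨ v = b := by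
        rcases hmid with h | h
        exacts [⟨a, h.1, Or.inl rfl⟩, ⟨b, h.1, Or.inr rfl⟩]
      exact ⟨v, hv, .single ⟨hx, hinl v hv, by simpa using hvab⟩,
        .single ⟨hinl v hv, hx, by simpa using hvab⟩⟩
  intro x hx y hy
  obtain ⟨v, hv, hxv, -⟩ := hnear x hx
  obtain ⟨v', hv', -, hvy⟩ := hnear y hy
  exact hxv.trans ((hold v hv v' hv').trans hvy)

/-- The neighbour of the terminal `r` replacing its neighbour `v` after subdividing `ab`. -/
noncomputable def subdivideEnd (a b r v : V) : V ⊕ Unit :=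
  open Classical in
  if (a = r ∧ b = v) ∨ (b = r ∧ a = v) then Sum.inr () else Sum.inl v

theorem adj_subdivideEnd {a b r v : V} (h : G.Adj r v) :
    (subdivideEdge G a b).Adj (Sum.inl r) (subdivideEnd a b r v) := by
  unfold subdivideEnd
  split_ifs with hif
  · simp only [subdivideEdge_adj_inl_inr]
    tauto
  · simp only [subdivideEdge_adj_inl_inl]
    refine ⟨h, ?_, ?_⟩ <;> rintro ⟨rfl, rfl⟩ <;> simp at hif

theorem subdivideEnd_mem (M : ThetaModel G) {a b r v : V} {i : Fin 3} (hr : r = M.s ∨ r = M.t)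
    (hv : v ∈ M.P i) : subdivideEnd a b r v ∈ M.subdividePart a b i := by
  unfold subdivideEnd
  split_ifs with hif
  · refine Or.inr ⟨rfl, ?_⟩
    rcases hif with ⟨rfl, rfl⟩ | ⟨rfl, rfl⟩
    exacts [Or.inr ⟨hv, hr⟩, Or.inl ⟨hv, Or.inr hr⟩]
  · exact Or.inl ⟨v, hv, rfl⟩

/-- The theta model obtained by subdividing an edge. -/
noncomputable def subdivide (M : ThetaModel G) (a b : V) : ThetaModel (subdivideEdge G a b) where
  s := Sum.inl M.s
  t := Sum.inl M.t
  P := M.subdividePart a b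
  u i := subdivideEnd a b M.s (M.u i)
  w i := subdivideEnd a b M.t (M.w i)
  ne h := M.ne (Sum.inl_injective h)
  s_notMem i := by simpa [subdividePart] using M.s_notMem i
  t_notMem i := by simpa [subdividePart] using M.t_notMem i
  disj i j v := by
    have hs := M.s_notMem
    have ht := M.t_notMem
    have hd := M.disj
    rintro (⟨x, hx, rfl⟩ | ⟨rfl, hx⟩) (⟨y, hy, h⟩ | ⟨h, hy⟩)
    · exact hd i j x hx (Sum.inl_injective h ▸ hy)
    · simp at h
    · simp at h
    · unfold MidMem at hx hy
      grind
  u_mem i := M.subdivideEnd_mem (Or.inl rfl) (M.u_mem i)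
  w_mem i := M.subdivideEnd_mem (Or.inr rfl) (M.w_mem i)
  u_ne_w i := by
    have hne := M.u_ne_w i
    have hst := M.ne
    have hu := M.u_mem i
    have ht := M.t_notMem i
    unfold subdivideEnd
    split_ifs with h₁ h₂
    · grind
    · simp
    · simp
    · simpa using hne
  adj_u i := adj_subdivideEnd (M.adj_u i)
  adj_w i := adj_subdivideEnd (M.adj_w i)
  conn := M.chainConnected_subdividePart a b

instance : DecidableRel D3.Adj := fun _ _ => decidable_of_iff' _ (fromRel_adj _ _ _)

/-- The theta model of `D₃` itself. -/
def ofD3 : ThetaModel D3 where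
  s := 0
  t := 1
  P i := {v | v = ![2, 4, 6] i ∨ v = ![3, 5, 7] i}
  u := ![2, 4, 6]
  w := ![3, 5, 7]
  ne := by decide
  s_notMem := by simp only [Set.mem_ofPred_eq]; decide
  t_notMem := by simp only [Set.mem_ofPred_eq]; decide
  disj := by simp only [Set.mem_ofPred_eq]; decide
  u_mem i := Or.inl rfl
  w_mem i := Or.inr rfl
  u_ne_w := by decide
  adj_u := by decide
  adj_w := by decide
  conn i := by
    have h : D3.Adj (![2, 4, 6] i) (![3, 5, 7] i) := by
      revert i; decide
    rintro x (rfl | rfl) y (rfl | rfl)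
    · exact .refl
    · exact .single ⟨Or.inl rfl, Or.inr rfl, h⟩
    · exact .single ⟨Or.inr rfl, Or.inl rfl, h.symm⟩
    · exact .refl

theorem nonempty_of_isSubdivisionOf {H : SimpleGraph V} (h : IsSubdivisionOf H D3) :
    Nonempty (ThetaModel H) :=
  h.of_invariant (p := fun G => Nonempty (ThetaModel G)) (fun e => Nonempty.map (comapIso e))
    (fun _ => Nonempty.map fun M => M.subdivide _ _) ⟨ofD3⟩

end ThetaModel

/-- Two nonadjacent vertices `s` and `t` and a numbering of the other vertices in which
adjacent vertices get consecutive numbers, a neighbour of `s` precedes and a neighbour of `t`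
succeeds its other neighbours. -/
structure LinearLayout {V : Type} (G : SimpleGraph V) where
  s : V
  t : V
  f : V → ℕ
  ne : s ≠ t
  not_adj : ¬ G.Adj s t
  inj : ∀ ⦃u v⦄, u ≠ s → u ≠ t → v ≠ s → v ≠ t → f u = f v → u = v
  consec : ∀ ⦃u v⦄, u ≠ s → u ≠ t → v ≠ s → v ≠ t → G.Adj u v → f u = f v + 1 ∨ f v = f u + 1
  left : ∀ ⦃u v⦄, G.Adj s u → v ≠ s → v ≠ t → G.Adj u v → f u < f v
  right : ∀ ⦃u v⦄, G.Adj t u → v ≠ s → v ≠ t → G.Adj u v → f v < f u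

namespace LinearLayout

variable {V : Type} {G : SimpleGraph V}

/-- The preimage of a linear layout under an isomorphism. -/
def comapIso {W : Type} {K : SimpleGraph W} (e : K ≃g G) (L : LinearLayout G) :
    LinearLayout K where
  s := e.symm L.s
  t := e.symm L.t
  f v := L.f (e v)
  ne h := L.ne (e.symm.injective h)
  not_adj h := L.not_adj (e.symm.map_adj_iff.1 h)
  inj u v hus hut hvs hvt h := e.injective <| by
    rw [ne_eq, RelIso.eq_symm_apply] at hus hut hvs hvt
    exact L.inj hus hut hvs hvt h
  consec u v hus hut hvs hvt h := by
    rw [ne_eq, RelIso.eq_symm_apply] at hus hut hvs hvt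
    exact L.consec hus hut hvs hvt (e.map_adj_iff.2 h)
  left u v hu hvs hvt h := by
    rw [ne_eq, RelIso.eq_symm_apply] at hvs hvt
    exact L.left (by simpa using e.map_adj_iff.2 hu) hvs hvt (e.map_adj_iff.2 h)
  right u v hu hvs hvt h := by
    rw [ne_eq, RelIso.eq_symm_apply] at hvs hvt
    exact L.right (by simpa using e.map_adj_iff.2 hu) hvs hvt (e.map_adj_iff.2 h)

/-- The numbering that inserts the subdivision vertex at position `k`. -/
def insertAt (f : V → ℕ) (k : ℕ) : V ⊕ Unit → ℕ
  | Sum.inl v => if f v < k then f v else f v + 1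
  | Sum.inr _ => k

/-- A layout of the subdivided graph, given a suitable position of the new vertex. -/
def subdivide (L : LinearLayout G) {a b : V} (k : ℕ)
    (hk : ∀ u v, u ≠ L.s → u ≠ L.t → v ≠ L.s → v ≠ L.t → G.Adj u v →
      ¬(u = a ∧ v = b) → ¬(u = b ∧ v = a) → L.f u < k → L.f v < k)
    (hend : ∀ u, u ≠ L.s → u ≠ L.t → (u = a ∨ u = b) → L.f u = k ∨ L.f u + 1 = k)
    (hs : ∀ u, (a = L.s ∧ u = b) ∨ (b = L.s ∧ u = a) → L.f u = k)
    (ht : ∀ u, (a = L.t ∧ u = b) ∨ (b = L.t ∧ u = a) → L.f u + 1 = k)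
    (hs' : ∀ u, u = a ∨ u = b → G.Adj L.s u → ¬(a = L.s ∨ b = L.s) → L.f u + 1 = k)
    (ht' : ∀ u, u = a ∨ u = b → G.Adj L.t u → ¬(a = L.t ∨ b = L.t) → L.f u = k) :
    LinearLayout (subdivideEdge G a b) where
  s := Sum.inl L.s
  t := Sum.inl L.t
  f := insertAt L.f k
  ne h := L.ne (Sum.inl_injective h)
  not_adj h := L.not_adj (subdivideEdge_adj_inl_inl.1 h).1
  inj := by
    rintro (u | u) (v | v) <;> simp only [ne_eq, Sum.inl.injEq, insertAt]
    · intro hus hut hvs hvt h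
      exact L.inj hus hut hvs hvt (by split_ifs at h <;> omega)
    · intros; split_ifs at * <;> omega
    · intros; split_ifs at * <;> omega
    · simp
  consec := by
    rintro (u | u) (v | v) <;>
      simp only [ne_eq, Sum.inl.injEq, insertAt, subdivideEdge_adj_inl_inl,
        subdivideEdge_adj_inl_inr, subdivideEdge_adj_inr_inl, subdivideEdge_adj_inr_inr]
    · rintro hus hut hvs hvt ⟨h, h₁, h₂⟩
      have h₃ := L.consec hus hut hvs hvt h
      have h₄ := hk u v hus hut hvs hvt h h₁ h₂
      have h₅ := hk v u hvs hvt hus hut h.symm (by tauto) (by tauto)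
      split_ifs <;> omega
    · intro hus hut _ _ h
      have := hend u hus hut h
      split_ifs <;> omega
    · intro _ _ hvs hvt h
      have := hend v hvs hvt h
      split_ifs <;> omega
    · simp
  left := by
    rintro (u | u) (v | v) <;>
      simp only [ne_eq, Sum.inl.injEq, insertAt, subdivideEdge_adj_inl_inl,
        subdivideEdge_adj_inl_inr, subdivideEdge_adj_inr_inl, subdivideEdge_adj_inr_inr]
    · rintro ⟨hu, -⟩ hvs hvt ⟨h, -⟩
      have := L.left hu hvs hvt h
      split_ifs <;> omega
    · rintro ⟨hu, h₁, h₂⟩ _ _ h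
      have := hs' u h hu (by rintro (rfl | rfl) <;> rcases h with rfl | rfl <;> simp_all)
      split_ifs <;> omega
    · intro hu hvs hvt h
      have := hs v (by grind)
      split_ifs <;> omega
    · simp
  right := by
    rintro (u | u) (v | v) <;>
      simp only [ne_eq, Sum.inl.injEq, insertAt, subdivideEdge_adj_inl_inl,
        subdivideEdge_adj_inl_inr, subdivideEdge_adj_inr_inl, subdivideEdge_adj_inr_inr]
    · rintro ⟨hu, -⟩ hvs hvt ⟨h, -⟩
      have := L.right hu hvs hvt h
      split_ifs <;> omega
    · rintro ⟨hu, h₁, h₂⟩ _ _ h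
      have := ht' u h hu (by rintro (rfl | rfl) <;> rcases h with rfl | rfl <;> simp_all)
      split_ifs <;> omega
    · intro hu hvs hvt h
      have := ht v (by grind)
      split_ifs <;> omega
    · simp

theorem nonempty_subdivideEdge (L : LinearLayout G) {a b : V} (hab : G.Adj a b) :
    Nonempty (LinearLayout (subdivideEdge G a b)) := by
  have key : ∀ {a b : V}, G.Adj a b → b ≠ L.s → b ≠ L.t →
      (a ≠ L.s → a ≠ L.t → L.f b = L.f a + 1) →
      Nonempty (LinearLayout (subdivideEdge G a b)) := by
    intro a b hab hbs hbt hle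
    have hst := L.not_adj
    have hne := L.ne
    have hts : ¬ G.Adj L.t L.s := fun h => hst h.symm
    have hss : ¬ G.Adj L.s L.s := G.irrefl
    have htt : ¬ G.Adj L.t L.t := G.irrefl
    by_cases has : a = L.s
    · subst has
      refine ⟨L.subdivide (L.f b) ?_ ?_ ?_ ?_ ?_ ?_⟩
      · intro u v hus hut hvs hvt huv h₁ h₂ hu
        have h₃ := L.consec hus hut hvs hvt huv
        by_contra hv
        obtain rfl : v = b := L.inj hvs hvt hbs hbt (by omega)
        have := L.left hab hus hut huv.symm
        omega
      all_goals grind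
    by_cases hat : a = L.t
    · subst hat
      refine ⟨L.subdivide (L.f b + 1) ?_ ?_ ?_ ?_ ?_ ?_⟩
      · intro u v hus hut hvs hvt huv h₁ h₂ hu
        have h₃ := L.consec hus hut hvs hvt huv
        by_contra hv
        obtain rfl : u = b := L.inj hus hut hbs hbt (by omega)
        have := L.right hab hvs hvt huv
        omega
      all_goals grind
    · have hfab := hle has hat
      refine ⟨L.subdivide (L.f b) ?_ ?_ ?_ ?_ ?_ ?_⟩
      · intro u v hus hut hvs hvt huv h₁ h₂ hu
        have h₃ := L.consec hus hut hvs hvt huv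
        by_contra hv
        exact h₁ ⟨L.inj hus hut has hat (by omega), L.inj hvs hvt hbs hbt (by omega)⟩
      · grind
      · grind
      · grind
      · rintro u (rfl | rfl) hu -
        · exact hfab.symm
        · have := L.left hu has hat hab.symm
          omega
      · rintro u (rfl | rfl) hu -
        · have := L.right hu hbs hbt hab
          omega
        · rfl
  by_cases hb : b = L.s ∨ b = L.t
  · rw [subdivideEdge_swap]
    have ha : a ≠ L.s ∧ a ≠ L.t := by
      have hst := L.not_adj
      have hts : ¬ G.Adj L.t L.s := fun h => hst h.symm
      have hss : ¬ G.Adj L.s L.s := G.irrefl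
      have htt : ¬ G.Adj L.t L.t := G.irrefl
      grind
    exact key hab.symm ha.1 ha.2 (by tauto)
  · push Not at hb
    by_cases ha : a ≠ L.s ∧ a ≠ L.t
    · rcases L.consec ha.1 ha.2 hb.1 hb.2 hab with h | h
      · rw [subdivideEdge_swap]
        exact key hab.symm ha.1 ha.2 fun _ _ => h
      · exact key hab hb.1 hb.2 fun _ _ => h
    · exact key hab hb.1 hb.2 (by tauto)

/-- The layout of `D₃` in which its three paths follow one another. -/
def ofD3 : LinearLayout D3 where
  s := 0
  t := 1
  f := ![0, 0, 0, 1, 2, 3, 4, 5]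
  ne := by decide
  not_adj := by decide
  inj := by decide
  consec := by decide
  left := by decide
  right := by decide

theorem nonempty_of_isSubdivisionOf {H : SimpleGraph V} (h : IsSubdivisionOf H D3) :
    Nonempty (LinearLayout H) :=
  h.of_invariant (p := fun G => Nonempty (LinearLayout G)) (fun e => Nonempty.map (comapIso e))
    (fun hab ⟨L⟩ => L.nonempty_subdivideEdge hab) ⟨ofD3⟩

end LinearLayout

section PathGraph

variable {n : ℕ}

theorem isTree_pathGraph (n : ℕ) : (pathGraph (n + 1)).IsTree := by
  refine ⟨pathGraph_connected n, ?_⟩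
  have key : ∀ u v : Fin (n + 1), u.val + 1 = v.val → (pathGraph (n + 1)).IsBridge s(u, v) := by
    intro u v huv
    rw [isBridge_iff_forall_walk_mem_edges]
    intro p
    obtain ⟨d, hd, h₁, h₂⟩ := p.exists_boundary_dart {x | x ≤ u} (by simp)
      (by simp only [Set.mem_ofPred_eq, Fin.le_def]; omega)
    have hadj := pathGraph_adj.1 d.adj
    simp only [Set.mem_ofPred_eq, Fin.le_def] at h₁ h₂
    have h₃ : d.fst = u := Fin.ext (by omega)
    have h₄ : d.snd = v := Fin.ext (by omega)
    have h₅ : d.edge = s(u, v) := by rw [← h₃, ← h₄]; rfl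
    exact h₅ ▸ List.mem_map_of_mem hd
  rw [isAcyclic_iff_forall_adj_isBridge]
  intro u v huv
  rcases pathGraph_adj.1 huv with h | h
  · exact key u v h
  · rw [Sym2.eq_swap]
    exact key v u h

/-- Convex sets of vertices of a path induce paths. -/
theorem isPathSet_pathGraph {S : Set (Fin n)} (hS : S.OrdConnected) (hne : S.Nonempty) :
    IsPathSet (pathGraph n) S := by
  refine ⟨?_, fun x _ => ?_⟩
  · have key : ∀ (d : ℕ) (x y : S), x.1.val + d = y.1.val →
        ((pathGraph n).induce S).Reachable x y := by
      intro d
      induction d with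
      | zero => intro x y h; rw [Subtype.ext (Fin.ext h)]
      | succ d ih =>
        intro x y h
        have hz : (⟨x.1.val + 1, by omega⟩ : Fin n) ∈ S :=
          hS.out x.2 y.2 ⟨by simp [Fin.le_def], by simp only [Fin.le_def]; omega⟩
        refine Reachable.trans (Adj.reachable ?_) (ih ⟨_, hz⟩ y (by simp; omega))
        simp [pathGraph_adj]
    have := hne.to_subtype
    refine ⟨fun x y => ?_⟩
    rcases le_total x.1.val y.1.val with h | h
    · exact key _ x y (Nat.add_sub_of_le h)
    · exact (key _ y x (Nat.add_sub_of_le h)).symm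
  · have h : {y | y ∈ S ∧ (pathGraph n).Adj x y} ⊆
        {y | y.val + 1 = x.val} ∪ {y | y.val = x.val + 1} := by
      rintro y ⟨-, hy⟩
      rcases pathGraph_adj.1 hy with h | h
      exacts [Or.inr h.symm, Or.inl h]
    have h₁ : {y : Fin n | y.val + 1 = x.val}.ncard ≤ 1 := by
      rw [Set.ncard_le_one]
      intro a ha b hb
      exact Fin.ext (by simp only [Set.mem_ofPred_eq] at ha hb; omega)
    have h₂ : {y : Fin n | y.val = x.val + 1}.ncard ≤ 1 := by
      rw [Set.ncard_le_one]
      intro a ha b hb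
      exact Fin.ext (by simp only [Set.mem_ofPred_eq] at ha hb; omega)
    have := (Set.ncard_le_ncard h).trans (Set.ncard_union_le _ _)
    omega

end PathGraph

namespace LinearLayout

variable {V : Type} {G : SimpleGraph V}

/-- The bag of the nonterminals numbered `k` or `k + 1` together with the terminals. -/
def layoutBag (L : LinearLayout G) (k : ℕ) : Set V :=
  {v | v = L.s ∨ v = L.t ∨ L.f v = k ∨ L.f v = k + 1}

theorem isPathSet_layoutBag (L : LinearLayout G) {N : ℕ} (hN : ∀ v, L.f v < N + 1) (v : V) :
    IsPathSet (pathGraph (N + 1)) {k : Fin (N + 1) | v ∈ L.layoutBag k} := by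
  refine isPathSet_pathGraph ⟨?_⟩ ⟨⟨L.f v, hN v⟩, by simp [layoutBag]⟩
  rintro x hx y hy z ⟨h₁, h₂⟩
  simp only [layoutBag, Set.mem_ofPred_eq, Fin.le_def] at hx hy h₁ h₂ ⊢
  grind

theorem ncard_layoutBag_le [Finite V] (L : LinearLayout G) (k : ℕ) :
    (L.layoutBag k).ncard ≤ 4 := by
  have hle : ∀ m, {v | v ≠ L.s ∧ v ≠ L.t ∧ L.f v = m}.ncard ≤ 1 := by
    intro m
    rw [Set.ncard_le_one]
    exact fun u hu v hv => L.inj hu.1 hu.2.1 hv.1 hv.2.1 (hu.2.2.trans hv.2.2.symm)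
  have hsub : L.layoutBag k ⊆ {L.s, L.t} ∪ ({v | v ≠ L.s ∧ v ≠ L.t ∧ L.f v = k} ∪
      {v | v ≠ L.s ∧ v ≠ L.t ∧ L.f v = k + 1}) := by
    intro v hv
    simp only [layoutBag, Set.mem_ofPred_eq, Set.mem_union, Set.mem_insert_iff,
      Set.mem_singleton_iff] at hv ⊢
    tauto
  calc
    _ ≤ _ := Set.ncard_le_ncard hsub
    _ ≤ 2 + (1 + 1) := (Set.ncard_union_le _ _).trans <| add_le_add
        ((Set.ncard_insert_le _ _).trans
        (by simp)) ((Set.ncard_union_le _ _).trans (add_le_add (hle _) (hle _)))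

/-- The spaghetti tree decomposition along a path given by a linear layout. -/
def toSpaghettiTD (L : LinearLayout G) {N : ℕ} (hN : ∀ v, L.f v < N + 1) : SpaghettiTD G where
  ι := Fin (N + 1)
  finι := inferInstance
  tree := pathGraph (N + 1)
  isTree := isTree_pathGraph N
  bag k := L.layoutBag k
  bag_cover v := ⟨⟨L.f v, hN v⟩, by simp [layoutBag]⟩
  bag_edge u v h := by
    by_cases hu : u = L.s ∨ u = L.t
    · exact ⟨⟨L.f v, hN v⟩, by simp only [layoutBag, Set.mem_ofPred_eq]; tauto⟩
    by_cases hv : v = L.s ∨ v = L.t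
    · exact ⟨⟨L.f u, hN u⟩, by simp only [layoutBag, Set.mem_ofPred_eq]; tauto⟩
    push Not at hu hv
    rcases L.consec hu.1 hu.2 hv.1 hv.2 h with h | h
    · exact ⟨⟨L.f v, hN v⟩, by simp only [layoutBag, Set.mem_ofPred_eq]; tauto⟩
    · exact ⟨⟨L.f u, hN u⟩, by simp only [layoutBag, Set.mem_ofPred_eq]; tauto⟩
  bag_conn v := (L.isPathSet_layoutBag hN v).1
  bag_path v := L.isPathSet_layoutBag hN v

theorem exists_spaghettiTD (L : LinearLayout G) [Finite V] :
    ∃ td : SpaghettiTD G, ∀ x, (td.bag x).ncard ≤ 4 := by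
  obtain ⟨N, hN⟩ := (Set.finite_range L.f).bddAbove
  exact ⟨L.toSpaghettiTD fun v => Nat.lt_succ_of_le (hN ⟨v, rfl⟩),
    fun x => L.ncard_layoutBag_le x.val⟩

end LinearLayout

/-- Every subdivision of `D₃` has spaghetti treewidth exactly three. -/
theorem statement3 {W : Type} [Fintype W] (H : SimpleGraph W)
    (h : IsSubdivisionOf H D3) : sptw H = 3 := by
  obtain ⟨M⟩ := ThetaModel.nonempty_of_isSubdivisionOf h
  obtain ⟨L⟩ := LinearLayout.nonempty_of_isSubdivisionOf h
  have hmem : 3 ∈ {k | ∃ td : SpaghettiTD H, ∀ x, (td.bag x).ncard ≤ k + 1} :=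
    L.exists_spaghettiTD
  refine le_antisymm (Nat.sInf_le hmem) (le_csInf ⟨3, hmem⟩ ?_)
  rintro k ⟨td, htd⟩
  obtain ⟨x, hx⟩ := M.exists_three_lt_ncard_bag td
  have := htd x
  omega
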